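/- arXiv:2102.00993 — 8 statements merged into one kernel-verified Lean document; each statement's English description precedes it below -/
import Mathlib

section
/- Let A and B be metric spaces, let (a_n) be a sequence in A, (b_n) a sequence in B, and let (ε_n) be a sequence of positive reals converging down to some ε > 0. Suppose that for every k ≥ 1, all indices i, j ≥ k and every real r ≥ 1/k: (i) if d(a_i, a_j) ≤ r then d(b_i, b_j) ≤ e^{ε_k}·r, and (ii) if d(a_i, a_j) ≥ r then d(b_i, b_j) ≥ e^{-ε_k}·r. Then for every strictly increasing sequence (i_n) of indices, the sequence (a_{i_n}) is Cauchy if and only if the sequence (b_{i_n}) is Cauchy. -/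
/-- If for each `k ≥ 1` the pairs with indices at least `k` approximately
preserve (with multiplicative error `e^{ε_k}`) all k-good atomic distance formulae,
where `(ε_n)` is a sequence of positive reals converging down to `ε > 0`, then a
subsequence of `(a_n)` is Cauchy iff the corresponding subsequence of `(b_n)` is. -/
theorem stmt3 {A B : Type*} [MetricSpace A] [MetricSpace B]
    (a : ℕ → A) (b : ℕ → B) (ε : ℝ) (hε : 0 < ε) (εs : ℕ → ℝ)
    (hgt : ∀ n, ε < εs n) (hanti : Antitone εs)
    (hlim : Filter.Tendsto εs Filter.atTop (nhds ε))
    (h : ∀ k : ℕ, 1 ≤ k → ∀ i j : ℕ, k ≤ i → k ≤ j → ∀ r : ℝ, 1 / (k : ℝ) ≤ r →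
      (dist (a i) (a j) ≤ r → dist (b i) (b j) ≤ Real.exp (εs k) * r) ∧
      (r ≤ dist (a i) (a j) → Real.exp (-(εs k)) * r ≤ dist (b i) (b j))) :
    ∀ idx : ℕ → ℕ, StrictMono idx →
      (CauchySeq (fun n => a (idx n)) ↔ CauchySeq (fun n => b (idx n))) := by
  intro idx hidx
  simp only [Metric.cauchySeq_iff]
  constructor
  · intro ha δ hδ
    obtain ⟨m, hm⟩ := exists_nat_one_div_lt (div_pos hδ (Real.exp_pos (εs 0)))
    obtain ⟨N, hN⟩ := ha (1 / ((m + 1 : ℕ) : ℝ)) (by positivity)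
    refine ⟨max N (m + 1), fun p hp q hq => ?_⟩
    have hb := (h (m + 1) (by omega) (idx p) (idx q)
      ((le_of_max_le_right hp).trans (hidx.id_le p))
      ((le_of_max_le_right hq).trans (hidx.id_le q)) _ le_rfl).1
      (hN p (le_of_max_le_left hp) q (le_of_max_le_left hq)).le
    calc dist (b (idx p)) (b (idx q))
        ≤ Real.exp (εs (m + 1)) * (1 / ((m + 1 : ℕ) : ℝ)) := hb
      _ ≤ Real.exp (εs 0) * (1 / ((m + 1 : ℕ) : ℝ)) := by
          gcongr
          exact hanti (Nat.zero_le _)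
      _ < δ := by
          rw [lt_div_iff₀ (Real.exp_pos _)] at hm
          push_cast
          linarith
  · intro hb δ hδ
    obtain ⟨m, hm⟩ := exists_nat_one_div_lt hδ
    obtain ⟨N, hN⟩ := hb (Real.exp (-(εs (m + 1))) * (1 / ((m + 1 : ℕ) : ℝ))) (by positivity)
    refine ⟨max N (m + 1), fun p hp q hq => ?_⟩
    by_contra! hge
    have hr : 1 / ((m + 1 : ℕ) : ℝ) ≤ dist (a (idx p)) (a (idx q)) := by
      push_cast
      exact hm.le.trans hge
    exact (hN p (le_of_max_le_left hp) q (le_of_max_le_left hq)).not_ge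
      ((h (m + 1) (by omega) (idx p) (idx q)
        ((le_of_max_le_right hp).trans (hidx.id_le p))
        ((le_of_max_le_right hq).trans (hidx.id_le q)) _ le_rfl).2 hr)
end

section
/- Let A and B be complete metric spaces. Then the Gromov–Hausdorff distance d_GH(A, B) equals the infimum of all ε ≥ 0 for which there exist dense subsets Â ⊆ A and B̂ ⊆ B, a correspondence R between Â and B̂, a metric space C, and isometric embeddings ι_A : Â → C and ι_B : B̂ → C such that d(ι_A(a), ι_B(b)) ≤ ε for all (a,b) ∈ R. -/
open EMetric Set ENNReal

/-- The Gromov–Hausdorff distance of two metric spaces: the infimum of the Hausdorff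
distances of their images under isometric embeddings into a common metric space. -/
noncomputable def ghEDist (X Y : Type) [MetricSpace X] [MetricSpace Y] : ℝ≥0∞ :=
  sInf { r : ℝ≥0∞ | ∃ (Z : Type) (_ : MetricSpace Z) (f : X → Z) (g : Y → Z),
    Isometry f ∧ Isometry g ∧ hausdorffEdist (range f) (range g) = r }

/-- The extension of an isometry from a dense subset to a complete space is an isometry. -/
theorem Isometry.dense_extend {α β : Type*} [PseudoMetricSpace α] [MetricSpace β]
    [CompleteSpace β] {s : Set α} (hs : Dense s) {f : s → β} (hf : Isometry f) :
    Isometry (hs.extend f) := by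
  have hc : Continuous (hs.extend f) :=
    (hs.uniformContinuous_extend hf.uniformContinuous).continuous
  refine Isometry.of_dist_eq ?_
  refine isClosed_property2 hs.denseRange_val
    (isClosed_eq ((hc.comp continuous_fst).dist (hc.comp continuous_snd)) continuous_dist) ?_
  intro x y
  rw [hs.extend_of_ind hf.uniformContinuous, hs.extend_of_ind hf.uniformContinuous, hf.dist_eq,
    Subtype.dist_eq]

/-- A continuous function and its restriction to a dense subset have ranges with the same
closure. -/
theorem Dense.closure_range_domRestrict {α β : Type*} [TopologicalSpace α] [TopologicalSpace β]
    {s : Set α} (hs : Dense s) {f : α → β} (hf : Continuous f) :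
    closure (range (s.domRestrict f)) = closure (range f) := by
  rw [range_domRestrict]
  exact (closure_mono (image_subset_range f s)).antisymm
    (closure_minimal (hf.range_subset_closure_image_dense hs) isClosed_closure)

/-- Isometric embeddings of dense subsets into a common metric space bound the Gromov–Hausdorff
distance by the Hausdorff distance of their images. -/
theorem ghEDist_le_hausdorffEDist_of_dense {A B C : Type} [MetricSpace A] [MetricSpace B]
    [MetricSpace C] {s : Set A} {t : Set B} (hs : Dense s) (ht : Dense t) {f : s → C} {g : t → C}
    (hf : Isometry f) (hg : Isometry g) :
    ghEDist A B ≤ Metric.hausdorffEDist (range f) (range g) := by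
  have hf' := UniformSpace.Completion.coe_isometry.comp hf
  have hg' := UniformSpace.Completion.coe_isometry.comp hg
  have hF := hf'.dense_extend hs
  have hG := hg'.dense_extend ht
  refine sInf_le ⟨UniformSpace.Completion C, inferInstance, _, _, hF, hG, ?_⟩
  have hFs : s.domRestrict (hs.extend ((↑) ∘ f : s → UniformSpace.Completion C)) = (↑) ∘ f :=
    funext (hs.extend_of_ind hf'.uniformContinuous)
  have hGt : t.domRestrict (ht.extend ((↑) ∘ g : t → UniformSpace.Completion C)) = (↑) ∘ g :=
    funext (ht.extend_of_ind hg'.uniformContinuous)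
  change Metric.hausdorffEDist _ _ = _
  rw [← Metric.hausdorffEDist_closure, ← hs.closure_range_domRestrict hF.continuous,
    ← ht.closure_range_domRestrict hG.continuous, hFs, hGt, Metric.hausdorffEDist_closure,
    range_comp, range_comp, Metric.hausdorffEDist_image UniformSpace.Completion.coe_isometry]

/-- For complete metric spaces `A`, `B`, the Gromov–Hausdorff distance
equals the infimum of all `ε` for which there are dense subsets `Â ⊆ A`, `B̂ ⊆ B`,
a correspondence `R` between `Â` and `B̂`, and isometric embeddings of `Â` and `B̂`
into a common metric space `C` taking related points to points at distance `≤ ε`. -/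
theorem stmt6 {A B : Type} [MetricSpace A] [MetricSpace B]
    [CompleteSpace A] [CompleteSpace B] :
    ghEDist A B =
      sInf { ε : ℝ≥0∞ |
        ∃ (Ahat : Set A) (Bhat : Set B), Dense Ahat ∧ Dense Bhat ∧
        ∃ R : Set (↥Ahat × ↥Bhat),
          (∀ a : ↥Ahat, ∃ b : ↥Bhat, (a, b) ∈ R) ∧
          (∀ b : ↥Bhat, ∃ a : ↥Ahat, (a, b) ∈ R) ∧
          ∃ (C : Type) (_ : MetricSpace C) (ιA : ↥Ahat → C) (ιB : ↥Bhat → C),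
            Isometry ιA ∧ Isometry ιB ∧
            ∀ p ∈ R, edist (ιA p.1) (ιB p.2) ≤ ε } := by
  apply le_antisymm
  · refine le_sInf ?_
    rintro ε ⟨s, t, hs, ht, R, hRs, hRt, C, _, f, g, hf, hg, hR⟩
    refine (ghEDist_le_hausdorffEDist_of_dense hs ht hf hg).trans
      (Metric.hausdorffEDist_le_of_mem_edist ?_ ?_)
    · rintro _ ⟨a, rfl⟩
      obtain ⟨b, hb⟩ := hRs a
      exact ⟨g b, mem_range_self b, hR _ hb⟩
    · rintro _ ⟨b, rfl⟩
      obtain ⟨a, ha⟩ := hRt b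
      exact ⟨f a, mem_range_self a, edist_comm (g b) (f a) ▸ hR _ ha⟩
  · refine le_sInf ?_
    rintro r ⟨Z, _, f, g, hf, hg, rfl⟩
    refine le_of_forall_gt_imp_ge_of_dense fun ε hε ↦ sInf_le ?_
    refine ⟨univ, univ, dense_univ, dense_univ, {p | edist (f p.1) (g p.2) ≤ ε}, ?_, ?_,
      Z, inferInstance, fun a ↦ f a, fun b ↦ g b, hf.comp isometry_subtype_coe,
      hg.comp isometry_subtype_coe, fun _ hp ↦ hp⟩
    · rintro ⟨a, -⟩
      obtain ⟨_, ⟨b, rfl⟩, hb⟩ :=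
        Metric.exists_edist_lt_of_hausdorffEDist_lt (mem_range_self a) hε
      exact ⟨⟨b, mem_univ b⟩, hb.le⟩
    · rintro ⟨b, -⟩
      obtain ⟨_, ⟨a, rfl⟩, ha⟩ := Metric.exists_edist_lt_of_hausdorffEDist_lt (mem_range_self b)
        (Metric.hausdorffEDist_comm.trans_lt hε)
      exact ⟨⟨a, mem_univ a⟩, (edist_comm (f a) (g b)).trans_le ha.le⟩
end

section
/- Let A and B be real Banach spaces, ε ≥ 0, and let f : A → B be a surjection. Suppose that for every n, all real coefficients c_0, …, c_{n−1} and all a_0, …, a_{n−1} ∈ A: (i) if ‖∑_{i<n} c_i a_i‖ ≤ 1 then ‖∑_{i<n} c_i f(a_i)‖ ≤ e^ε, and (ii) if ‖∑_{i<n} c_i a_i‖ ≥ 1 then ‖∑_{i<n} c_i f(a_i)‖ ≥ e^{-ε}. Then f is linear and e^ε-bi-Lipschitz, i.e. e^{-ε}·‖a − a'‖ ≤ ‖f(a) − f(a')‖ ≤ e^ε·‖a − a'‖ for all a, a' ∈ A. -/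
open scoped BigOperators

section ApproximateLinearRelations

variable {A B : Type*} [NormedAddCommGroup A] [NormedSpace ℝ A]
  [NormedAddCommGroup B] [NormedSpace ℝ B] {f : A → B} {n : ℕ} {K : ℝ}

theorem sum_smul_mul {E : Type*} [AddCommGroup E] [Module ℝ E] (t : ℝ) (c : Fin n → ℝ)
    (v : Fin n → E) : ∑ i, (t * c i) • v i = t • ∑ i, c i • v i := by
  simp only [Finset.smul_sum, mul_smul]

theorem norm_sum_smul_le_of_unit_bound
    (h : ∀ (c : Fin n → ℝ) (a : Fin n → A),
      ‖∑ i, c i • a i‖ ≤ 1 → ‖∑ i, c i • f (a i)‖ ≤ K)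
    (c : Fin n → ℝ) (a : Fin n → A) :
    ‖∑ i, c i • f (a i)‖ ≤ K * ‖∑ i, c i • a i‖ := by
  have key : ∀ t : ℝ, 0 < t → t * ‖∑ i, c i • a i‖ ≤ 1 →
      t * ‖∑ i, c i • f (a i)‖ ≤ K := by
    intro t ht hle
    have := h (fun i => t * c i) a
    simp only [sum_smul_mul, norm_smul, Real.norm_eq_abs, abs_of_pos ht] at this
    exact this hle
  rcases (norm_nonneg (∑ i, c i • a i)).eq_or_lt with h0 | hpos
  · rw [← h0, mul_zero]
    by_contra! hlt
    obtain ⟨t, ht⟩ := exists_nat_gt (K / ‖∑ i, c i • f (a i)‖)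
    rw [div_lt_iff₀ hlt] at ht
    have := key (t + 1) (by positivity) (by rw [← h0]; simp)
    linarith
  · have := key ‖∑ i, c i • a i‖⁻¹ (inv_pos.2 hpos) (inv_mul_cancel₀ hpos.ne').le
    rwa [inv_mul_le_iff₀ hpos, mul_comm] at this

theorem le_norm_sum_smul_of_unit_bound
    (h : ∀ (c : Fin n → ℝ) (a : Fin n → A),
      1 ≤ ‖∑ i, c i • a i‖ → K ≤ ‖∑ i, c i • f (a i)‖)
    (c : Fin n → ℝ) (a : Fin n → A) :
    K * ‖∑ i, c i • a i‖ ≤ ‖∑ i, c i • f (a i)‖ := by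
  rcases (norm_nonneg (∑ i, c i • a i)).eq_or_lt with h0 | hpos
  · simp [← h0]
  · have := h (fun i => ‖∑ i, c i • a i‖⁻¹ * c i) a
    simp only [sum_smul_mul, norm_smul, norm_inv, norm_norm] at this
    have := this (inv_mul_cancel₀ hpos.ne').ge
    rwa [le_inv_mul_iff₀ hpos, mul_comm] at this

end ApproximateLinearRelations

/-- A surjection between real Banach spaces which preserves, with
multiplicative error `e^ε`, the atomic formulae `P(t)` (`‖t‖ ≤ 1`) and `Q(t)`
(`‖t‖ ≥ 1`) for all finite linear combinations `t`, is linear and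
`e^ε`-bi-Lipschitz. -/
theorem stmt9 {A B : Type*}
    [NormedAddCommGroup A] [NormedSpace ℝ A] [CompleteSpace A]
    [NormedAddCommGroup B] [NormedSpace ℝ B] [CompleteSpace B]
    (ε : ℝ) (hε : 0 ≤ ε) (f : A → B) (hf : Function.Surjective f)
    (h : ∀ (n : ℕ) (c : Fin n → ℝ) (a : Fin n → A),
      (‖∑ i, c i • a i‖ ≤ 1 → ‖∑ i, c i • f (a i)‖ ≤ Real.exp ε) ∧
      (1 ≤ ‖∑ i, c i • a i‖ → Real.exp (-ε) ≤ ‖∑ i, c i • f (a i)‖)) :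
    IsLinearMap ℝ f ∧
      ∀ a a' : A, Real.exp (-ε) * ‖a - a'‖ ≤ ‖f a - f a'‖ ∧
        ‖f a - f a'‖ ≤ Real.exp ε * ‖a - a'‖ := by
  have upper := fun n => norm_sum_smul_le_of_unit_bound (n := n) fun c a => (h n c a).1
  have lower := fun n => le_norm_sum_smul_of_unit_bound (n := n) fun c a => (h n c a).2
  refine ⟨⟨fun x y => ?_, fun r x => ?_⟩, fun a a' => ⟨?_, ?_⟩⟩
  · have := upper 3 ![1, -1, -1] ![x + y, x, y]
    simp only [Fin.sum_univ_three, Matrix.cons_val, one_smul, neg_smul] at this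
    rw [show x + y + -x + -y = 0 by abel, norm_zero, mul_zero, norm_le_zero_iff] at this
    rw [← sub_eq_zero, ← this]
    abel
  · have := upper 2 ![1, -r] ![r • x, x]
    simp only [Fin.sum_univ_two, Matrix.cons_val, one_smul, neg_smul, add_neg_cancel,
      norm_zero, mul_zero, norm_le_zero_iff] at this
    rwa [← sub_eq_zero, sub_eq_add_neg]
  · simpa [sub_eq_add_neg] using lower 2 ![1, -1] ![a, a']
  · simpa [sub_eq_add_neg] using upper 2 ![1, -1] ![a, a']
end

section
/- Let A and B be real Banach spaces, let (a_n) be a sequence in A, (b_n) a sequence in B, and let (ε_n) be a sequence of positive reals converging to some ε > 0. Suppose that for every k ≥ 1, all indices i_0, …, i_{k−1} ≥ k and all real coefficients c_0, …, c_{k−1} with |c_j| ≤ k: (i) if ‖∑_{j<k} c_j a_{i_j}‖ ≤ 1 then ‖∑_{j<k} c_j b_{i_j}‖ ≤ e^{ε_k}, and (ii) if ‖∑_{j<k} c_j a_{i_j}‖ ≥ 1 then ‖∑_{j<k} c_j b_{i_j}‖ ≥ e^{-ε_k}. Then for every strictly increasing sequence (i_n) of indices, the sequence (a_{i_n}) is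 Cauchy if and only if the sequence (b_{i_n}) is Cauchy. -/
open scoped BigOperators

/-- If eventually closeness of terms of `u` forces closeness of the corresponding terms of `v`,
then Cauchy subsequences of `u` give Cauchy subsequences of `v`. -/
theorem cauchySeq_comp_of_eventually_norm_sub_lt {A B : Type*}
    [SeminormedAddCommGroup A] [SeminormedAddCommGroup B] {u : ℕ → A} {v : ℕ → B}
    (huv : ∀ δ > 0, ∃ η > 0, ∃ N : ℕ, ∀ m ≥ N, ∀ n ≥ N, ‖u m - u n‖ < η → ‖v m - v n‖ < δ)
    {idx : ℕ → ℕ} (hidx : StrictMono idx) (hu : CauchySeq (fun n => u (idx n))) :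
    CauchySeq (fun n => v (idx n)) := by
  rw [Metric.cauchySeq_iff] at hu ⊢
  intro δ hδ
  obtain ⟨η, hη, N, hN⟩ := huv δ hδ
  obtain ⟨M, hM⟩ := hu η hη
  refine ⟨max M N, fun m hm n hn => ?_⟩
  have hle : ∀ p ≥ max M N, N ≤ idx p := fun p hp =>
    (le_of_max_le_right hp).trans (hidx.le_apply)
  have hd := hM m (le_of_max_le_left hm) n (le_of_max_le_left hn)
  rw [dist_eq_norm] at hd ⊢
  exact hN _ (hle m hm) _ (hle n hn) hd

/-- The scaled difference `k • (x m - x n)` is a `k`-good combination once `2 ≤ k`; the choice of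
indices and coefficients serves two sequences at once. -/
theorem exists_sum_smul_eq_smul_sub {E F : Type*} [AddCommGroup E] [Module ℝ E]
    [AddCommGroup F] [Module ℝ F] (x : ℕ → E) (y : ℕ → F) {k m n : ℕ} (hk : 2 ≤ k) (hm : k ≤ m) (hn : k ≤ n) :
    ∃ (i : Fin k → ℕ) (c : Fin k → ℝ), (∀ j, k ≤ i j) ∧ (∀ j, |c j| ≤ (k : ℝ)) ∧
      ∑ j, c j • x (i j) = (k : ℝ) • (x m - x n) ∧
      ∑ j, c j • y (i j) = (k : ℝ) • (y m - y n) := by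
  obtain ⟨l, rfl⟩ := Nat.exists_eq_add_of_le' hk
  refine ⟨Fin.cons m fun _ => n,
    Fin.cons ((l + 2 : ℕ) : ℝ) (Fin.cons (-((l + 2 : ℕ) : ℝ)) 0), ?_, ?_, ?_, ?_⟩
  · exact Fin.cases hm fun _ => hn
  · refine Fin.cases ?_ (Fin.cases ?_ fun _ => ?_)
    · simp only [Fin.cons_zero, Nat.abs_cast, le_refl]
    · simp only [Fin.cons_succ, Fin.cons_zero, abs_neg, Nat.abs_cast, le_refl]
    · simp only [Fin.cons_succ, Pi.zero_apply, abs_zero, Nat.cast_nonneg]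
  all_goals
    rw [Fin.sum_univ_succ, Fin.sum_univ_succ, smul_sub, sub_eq_add_neg]
    simp only [Fin.cons_zero, Fin.cons_succ, Pi.zero_apply, zero_smul, Finset.sum_const_zero,
      add_zero, neg_smul]

/-- If for each `k ≥ 1` the tuples with indices at least `k`
approximately preserve (with multiplicative error `e^{ε_k}`) all k-good atomic
formulae `P(t)` (`‖t‖ ≤ 1`) and `Q(t)` (`‖t‖ ≥ 1`), where `(ε_n)` is a sequence of
positive reals converging to `ε > 0`, then a subsequence of `(a_n)` is Cauchy iff
the corresponding subsequence of `(b_n)` is. -/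
theorem stmt11 {A B : Type*}
    [NormedAddCommGroup A] [NormedSpace ℝ A] [CompleteSpace A]
    [NormedAddCommGroup B] [NormedSpace ℝ B] [CompleteSpace B]
    (a : ℕ → A) (b : ℕ → B) (ε : ℝ) (hε : 0 < ε) (εs : ℕ → ℝ)
    (hpos : ∀ n, 0 < εs n) (hlim : Filter.Tendsto εs Filter.atTop (nhds ε))
    (h : ∀ k : ℕ, 1 ≤ k → ∀ i : Fin k → ℕ, (∀ j, k ≤ i j) →
      ∀ c : Fin k → ℝ, (∀ j, |c j| ≤ (k : ℝ)) →
        (‖∑ j, c j • a (i j)‖ ≤ 1 → ‖∑ j, c j • b (i j)‖ ≤ Real.exp (εs k)) ∧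
        (1 ≤ ‖∑ j, c j • a (i j)‖ → Real.exp (-(εs k)) ≤ ‖∑ j, c j • b (i j)‖)) :
    ∀ idx : ℕ → ℕ, StrictMono idx →
      (CauchySeq (fun n => a (idx n)) ↔ CauchySeq (fun n => b (idx n))) := by
  have key : ∀ k m n : ℕ, 2 ≤ k → k ≤ m → k ≤ n →
      (k * ‖a m - a n‖ ≤ 1 → k * ‖b m - b n‖ ≤ Real.exp (εs k)) ∧
      (1 ≤ k * ‖a m - a n‖ → Real.exp (-(εs k)) ≤ k * ‖b m - b n‖) := by
    intro k m n hk hm hn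
    obtain ⟨i, c, hi, hc, ha, hb⟩ := exists_sum_smul_eq_smul_sub a b hk hm hn
    obtain ⟨hP, hQ⟩ := h k (by omega) i hi c hc
    rw [ha, hb, norm_smul, norm_smul, Real.norm_natCast] at hP hQ
    exact ⟨hP, hQ⟩
  intro idx hidx
  constructor <;> refine cauchySeq_comp_of_eventually_norm_sub_lt (fun δ hδ => ?_) hidx
  · obtain ⟨M, hM⟩ := hlim.bddAbove_range
    obtain ⟨l, hl⟩ := exists_nat_gt (Real.exp M / δ)
    have hk : (0 : ℝ) < (l + 2 : ℕ) := by positivity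
    refine ⟨1 / (l + 2 : ℕ), by positivity, l + 2, fun m hm n hn hlt => ?_⟩
    rw [lt_div_iff₀' hk] at hlt
    have hb := (key (l + 2) m n (by omega) hm hn).1 hlt.le
    have hexp : Real.exp (εs (l + 2)) ≤ Real.exp M := Real.exp_le_exp.2 (hM ⟨_, rfl⟩)
    rw [div_lt_iff₀ hδ] at hl
    refine lt_of_mul_lt_mul_left (hb.trans_lt ?_) hk.le
    push_cast
    nlinarith
  · obtain ⟨l, hl⟩ := exists_nat_gt (1 / δ)
    have hk : (0 : ℝ) < (l + 2 : ℕ) := by positivity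
    refine ⟨Real.exp (-(εs (l + 2))) / (l + 2 : ℕ), by positivity, l + 2,
      fun m hm n hn hlt => ?_⟩
    rw [lt_div_iff₀' hk] at hlt
    have ha := lt_of_not_ge fun hge => hlt.not_ge ((key (l + 2) m n (by omega) hm hn).2 hge)
    rw [div_lt_iff₀ hδ] at hl
    refine lt_of_mul_lt_mul_left (ha.trans ?_) hk.le
    push_cast
    nlinarith
end

section
/- Let A and B be real Banach spaces with closed unit balls B_A and B_B, and let ε > 0. Then the following are equivalent: (1) the Kadets distance d_K(A,B) is less than ε, i.e. there exist a real Banach space Z and linear isometric embeddings ι_A : A → Z and ι_B : B → Z such that the Hausdorff distance between ι_A(B_A) and ι_B(B_B) in Z is less than ε; (2) there is ε' ∈ (0, ε) such that for ALL dense subsets Â ⊆ B_A and B̂ ⊆ B_B there exist a correspondence R between Â and B̂, a real Banach space C, and linear isometric embeddings ι_A : A → C and ι_B : B → C with ‖ι_A(a) − ι_B(b)‖ ≤ ε' for every (a,b) ∈ R. -/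
open EMetric Set ENNReal

/-- If `y` is at distance less than `δ` from the image of a point of `s` under an isometry, and
`t` is dense in `s`, then `y` is at distance less than `δ` from the image of a point of `t`. -/
theorem exists_dist_lt_of_subset_closure {X Y : Type*} [PseudoMetricSpace X] [PseudoMetricSpace Y]
    {f : X → Y} (hf : Isometry f) {s t : Set X} (hst : s ⊆ closure t) {y : Y} {δ : ℝ} {x : X}
    (hx : x ∈ s) (hxy : dist y (f x) < δ) : ∃ x' ∈ t, dist y (f x') < δ := by
  obtain ⟨x', hx', hlt⟩ := Metric.mem_closure_iff.1 (hst hx) (δ - dist y (f x)) (sub_pos.2 hxy)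
  refine ⟨x', hx', ?_⟩
  have := dist_triangle y (f x) (f x')
  rw [hf.dist_eq] at this
  linarith

/-- For real Banach spaces `A`, `B` and `ε > 0`, the Kadets distance is
less than `ε` (i.e. there are linear isometric embeddings of `A` and `B` into a common
Banach space `Z` under which the images of the closed unit balls have Hausdorff
distance `< ε`) iff for some `ε' ∈ (0, ε)`, for ALL dense subsets `Â` of the unit ball
of `A` and `B̂` of the unit ball of `B` there is a correspondence `R` between `Â` and
`B̂` realized by linear isometric embeddings into a common Banach space `C` with
`‖ι_A(a) − ι_B(b)‖ ≤ ε'` for all `(a, b) ∈ R`. -/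
theorem stmt13 {A B : Type}
    [NormedAddCommGroup A] [NormedSpace ℝ A] [CompleteSpace A]
    [NormedAddCommGroup B] [NormedSpace ℝ B] [CompleteSpace B]
    (ε : ℝ) (hε : 0 < ε) :
    (∃ (Z : Type) (_ : NormedAddCommGroup Z) (_ : NormedSpace ℝ Z) (_ : CompleteSpace Z)
      (ιA : A →ₗᵢ[ℝ] Z) (ιB : B →ₗᵢ[ℝ] Z),
        hausdorffEdist (ιA '' Metric.closedBall 0 1) (ιB '' Metric.closedBall 0 1)
          < ENNReal.ofReal ε) ↔
    (∃ ε' : ℝ, ε' ∈ Set.Ioo 0 ε ∧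
      ∀ (Ahat : Set A) (Bhat : Set B),
        Ahat ⊆ Metric.closedBall 0 1 → Metric.closedBall 0 1 ⊆ closure Ahat →
        Bhat ⊆ Metric.closedBall 0 1 → Metric.closedBall 0 1 ⊆ closure Bhat →
        ∃ R : Set (A × B),
          Prod.fst '' R = Ahat ∧ Prod.snd '' R = Bhat ∧
          ∃ (C : Type) (_ : NormedAddCommGroup C) (_ : NormedSpace ℝ C)
            (_ : CompleteSpace C) (ιA : A →ₗᵢ[ℝ] C) (ιB : B →ₗᵢ[ℝ] C),
            ∀ p ∈ R, ‖ιA p.1 - ιB p.2‖ ≤ ε') := by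
  constructor
  · rintro ⟨Z, _, _, hZ, ιA, ιB, h⟩
    obtain ⟨δ, hδ0, hδ, hδε⟩ := ENNReal.lt_iff_exists_real_btwn.1 h
    have hδε' : δ < ε := (ENNReal.ofReal_lt_ofReal_iff hε).1 hδε
    have hδpos : 0 < δ := ENNReal.ofReal_pos.1 (bot_le.trans_lt hδ)
    refine ⟨δ, ⟨hδpos, hδε'⟩, fun Ahat Bhat hA hA' hB hB' => ?_⟩
    refine ⟨{p | p.1 ∈ Ahat ∧ p.2 ∈ Bhat ∧ ‖ιA p.1 - ιB p.2‖ ≤ δ}, ?_, ?_,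
      Z, _, _, hZ, ιA, ιB, fun p hp => hp.2.2⟩
    · refine Subset.antisymm (by rintro _ ⟨p, hp, rfl⟩; exact hp.1) fun a ha => ?_
      obtain ⟨_, ⟨b, hb, rfl⟩, hab⟩ :=
        Metric.exists_edist_lt_of_hausdorffEDist_lt (mem_image_of_mem ιA (hA ha)) hδ
      rw [edist_lt_ofReal] at hab
      obtain ⟨b', hb', hab'⟩ := exists_dist_lt_of_subset_closure ιB.isometry hB' hb hab
      exact ⟨(a, b'), ⟨ha, hb', by simpa [dist_eq_norm] using hab'.le⟩, rfl⟩
    · refine Subset.antisymm (by rintro _ ⟨p, hp, rfl⟩; exact hp.2.1) fun b hb => ?_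
      replace hδ := Metric.hausdorffEDist_comm.trans_lt hδ
      obtain ⟨_, ⟨a, ha, rfl⟩, hab⟩ :=
        Metric.exists_edist_lt_of_hausdorffEDist_lt (mem_image_of_mem ιB (hB hb)) hδ
      rw [edist_lt_ofReal] at hab
      obtain ⟨a', ha', hab'⟩ := exists_dist_lt_of_subset_closure ιA.isometry hA' ha hab
      rw [dist_comm, dist_eq_norm] at hab'
      exact ⟨(a', b), ⟨ha', hb, hab'.le⟩, rfl⟩
  · rintro ⟨ε', ⟨-, hε'⟩, h⟩
    obtain ⟨R, hRA, hRB, C, _, _, hC, ιA, ιB, hR⟩ :=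
      h _ _ Subset.rfl subset_closure Subset.rfl subset_closure
    refine ⟨C, _, _, hC, ιA, ιB,
      lt_of_le_of_lt ?_ ((ENNReal.ofReal_lt_ofReal_iff hε).2 hε')⟩
    have hdist : ∀ p ∈ R, edist (ιA p.1) (ιB p.2) ≤ ENNReal.ofReal ε' := fun p hp => by
      rw [edist_dist, dist_eq_norm]
      exact ENNReal.ofReal_le_ofReal (hR p hp)
    rw [← hRA, ← hRB]
    refine Metric.hausdorffEDist_le_of_mem_edist ?_ ?_
    · rintro _ ⟨_, ⟨p, hp, rfl⟩, rfl⟩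
      exact ⟨_, mem_image_of_mem ιB (mem_image_of_mem _ hp), hdist p hp⟩
    · rintro _ ⟨_, ⟨p, hp, rfl⟩, rfl⟩
      exact ⟨_, mem_image_of_mem ιA (mem_image_of_mem _ hp),
        (edist_comm _ _).trans_le (hdist p hp)⟩
end

section
/- Let A and B be real Banach spaces with closed unit balls B_A and B_B, let 0 < δ < ε, and let R be a correspondence between a dense subset of B_A and a dense subset of B_B such that for every n, all (a_0,b_0), …, (a_{n−1},b_{n−1}) ∈ R and all real coefficients λ_0, …, λ_{n−1} with ∑_{i<n}|λ_i| = 1 we have |‖∑_{i<n} λ_i a_i‖ − ‖∑_{i<n} λ_i b_i‖| ≤ ε − δ. Then there exist δ', δ'' > 0 (indeed δ' = δ/2 and δ'' = δ/(2ε − δ) work) such that for every n, all (a_0,b_0), …, (a_{n−1},b_{n−1}) ∈ R satisfying max{‖a_i‖, ‖b_i‖} > 1 − δ'' for each i < n, and all real coefficients λ_0, …, λ_{n−1} with ∑_{i<n}|λ_i| = 1, we have |‖∑_{i<n} λ_i a_i‖ − ‖∑_{i<n} λ_i b_i‖| ≤ (ε − δ')·∑_{i<n} |λ_i|·max{‖a_i‖,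 ‖b_i‖}. -/
open scoped BigOperators

/-- If a correspondence `R` between dense subsets of the closed unit
balls of real Banach spaces `A` and `B` preserves the norms of absolutely convex
combinations up to additive error `ε − δ` (where `0 < δ < ε`), then there are
`δ', δ'' > 0` (indeed `δ' = δ/2` and `δ'' = δ/(2ε − δ)` work) such that for pairs in
`R` whose points have norm `max {‖a_i‖, ‖b_i‖} > 1 − δ''`, we have
`|‖∑ λ_i a_i‖ − ‖∑ λ_i b_i‖| ≤ (ε − δ')·∑ |λ_i|·max {‖a_i‖, ‖b_i‖}`. -/
theorem stmt14 {A B : Type}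
    [NormedAddCommGroup A] [NormedSpace ℝ A] [CompleteSpace A]
    [NormedAddCommGroup B] [NormedSpace ℝ B] [CompleteSpace B]
    (ε δ : ℝ) (hδ : 0 < δ) (hδε : δ < ε)
    (Ahat : Set A) (Bhat : Set B)
    (hA₁ : Ahat ⊆ Metric.closedBall 0 1) (hA₂ : Metric.closedBall 0 1 ⊆ closure Ahat)
    (hB₁ : Bhat ⊆ Metric.closedBall 0 1) (hB₂ : Metric.closedBall 0 1 ⊆ closure Bhat)
    (R : Set (A × B)) (hdom : Prod.fst '' R = Ahat) (hran : Prod.snd '' R = Bhat)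
    (h : ∀ (n : ℕ) (p : Fin n → A × B), (∀ i, p i ∈ R) →
      ∀ lam : Fin n → ℝ, ∑ i, |lam i| = 1 →
        |‖∑ i, lam i • (p i).1‖ - ‖∑ i, lam i • (p i).2‖| ≤ ε - δ) :
    ∃ δ' δ'' : ℝ, 0 < δ' ∧ 0 < δ'' ∧ δ' = δ / 2 ∧ δ'' = δ / (2 * ε - δ) ∧
      ∀ (n : ℕ) (p : Fin n → A × B), (∀ i, p i ∈ R) →
        (∀ i, 1 - δ'' < max ‖(p i).1‖ ‖(p i).2‖) →
        ∀ lam : Fin n → ℝ, ∑ i, |lam i| = 1 →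
          |‖∑ i, lam i • (p i).1‖ - ‖∑ i, lam i • (p i).2‖|
            ≤ (ε - δ') * ∑ i, |lam i| * max ‖(p i).1‖ ‖(p i).2‖ := by
  have hpos : 0 < 2 * ε - δ := by linarith
  refine ⟨δ / 2, δ / (2 * ε - δ), by positivity, by positivity, rfl, rfl, ?_⟩
  intro n p hp hmax lam hlam
  have hsum : 1 - δ / (2 * ε - δ) ≤ ∑ i, |lam i| * max ‖(p i).1‖ ‖(p i).2‖ := by
    calc 1 - δ / (2 * ε - δ) = ∑ i, |lam i| * (1 - δ / (2 * ε - δ)) := by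
          rw [← Finset.sum_mul, hlam, one_mul]
      _ ≤ _ := Finset.sum_le_sum fun i _ =>
          mul_le_mul_of_nonneg_left (hmax i).le (abs_nonneg _)
  calc |‖∑ i, lam i • (p i).1‖ - ‖∑ i, lam i • (p i).2‖| ≤ ε - δ := h n p hp lam hlam
    _ = (ε - δ / 2) * (1 - δ / (2 * ε - δ)) := by
        have hcancel : (2 * ε - δ) * (δ / (2 * ε - δ)) = δ := by field_simp [hpos.ne']
        linear_combination hcancel / 2
    _ ≤ _ := mul_le_mul_of_nonneg_left hsum (by linarith)
end

section
/- Let A and B be real Banach spaces with closed unit balls B_A and B_B, let 0 < δ < ε, and let R be a correspondence between a dense subset of B_A and a dense subset of B_B such that for every n, all (a_0,b_0), …, (a_{n−1},b_{n−1}) ∈ R and all real coefficients λ_0, …, λ_{n−1} with ∑_{i<n}|λ_i| = 1 we have |‖∑_{i<n} λ_i a_i‖ − ‖∑_{i<n} λ_i b_i‖| ≤ ε − δ. Then there exist a real Banach space C and linear isometric embeddings ι_A : A → C and ι_B : B → C such that the Hausdorff distance between ι_A(B_A) and ι_B(B_B) in C is less than ε; in particular the Kadets distance d_K(A,B) is less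 than ε. -/
open EMetric Set ENNReal
open scoped BigOperators

/-- The Kadets distance of two real Banach spaces: the infimum of the Hausdorff
distances of the images of their closed unit balls under linear isometric embeddings
into a common Banach space. -/
noncomputable def kadetsEDist (A B : Type)
    [NormedAddCommGroup A] [NormedSpace ℝ A]
    [NormedAddCommGroup B] [NormedSpace ℝ B] : ℝ≥0∞ :=
  sInf { r : ℝ≥0∞ | ∃ (Z : Type) (_ : NormedAddCommGroup Z) (_ : NormedSpace ℝ Z)
    (_ : CompleteSpace Z) (ιA : A →ₗᵢ[ℝ] Z) (ιB : B →ₗᵢ[ℝ] Z),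
    hausdorffEdist (ιA '' Metric.closedBall 0 1) (ιB '' Metric.closedBall 0 1) = r }

/-- A linear isometry `f` such that adding elements of `N` never decreases the norm
on its range descends to a linear isometry into the quotient by `N`. -/
noncomputable def LinearIsometry.toQuotient {E V : Type*}
    [NormedAddCommGroup E] [NormedSpace ℝ E] [NormedAddCommGroup V] [NormedSpace ℝ V]
    (f : E →ₗᵢ[ℝ] V) (N : Submodule ℝ V) [IsClosed (N : Set V)]
    (hf : ∀ x, ∀ n ∈ N, ‖x‖ ≤ ‖f x + n‖) : E →ₗᵢ[ℝ] V ⧸ N where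
  toLinearMap := N.mkQ ∘ₗ f.toLinearMap
  norm_map' x := by
    refine le_antisymm ((Submodule.Quotient.norm_mk_le N (f x)).trans_eq (f.norm_map x)) ?_
    refine (QuotientAddGroup.le_norm_iff (S := N.toAddSubgroup)).2 fun m hm ↦ ?_
    have hmem : m - f x ∈ N := (Submodule.Quotient.eq N).1 hm
    simpa using hf x _ hmem

theorem LinearIsometry.toQuotient_apply {E V : Type*}
    [NormedAddCommGroup E] [NormedSpace ℝ E] [NormedAddCommGroup V] [NormedSpace ℝ V]
    (f : E →ₗᵢ[ℝ] V) (N : Submodule ℝ V) [IsClosed (N : Set V)]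
    (hf : ∀ x, ∀ n ∈ N, ‖x‖ ≤ ‖f x + n‖) (x : E) :
    f.toQuotient N hf x = Submodule.Quotient.mk (f x) := rfl

/-- The defect bound for absolutely convex combinations extends to all finite linear
combinations by homogeneity. -/
theorem abs_norm_sub_norm_le_of_absConvex {A B : Type*}
    [NormedAddCommGroup A] [NormedSpace ℝ A] [NormedAddCommGroup B] [NormedSpace ℝ B]
    {c : ℝ} {R : Set (A × B)}
    (h : ∀ (n : ℕ) (p : Fin n → A × B), (∀ i, p i ∈ R) →
      ∀ lam : Fin n → ℝ, ∑ i, |lam i| = 1 →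
        |‖∑ i, lam i • (p i).1‖ - ‖∑ i, lam i • (p i).2‖| ≤ c)
    (s : Finset R) (l : R → ℝ) :
    |‖∑ r ∈ s, l r • r.1.1‖ - ‖∑ r ∈ s, l r • r.1.2‖| ≤ c * ∑ r ∈ s, |l r| := by
  set L := ∑ r ∈ s, |l r|
  have hL0 : 0 ≤ L := Finset.sum_nonneg fun _ _ ↦ abs_nonneg _
  rcases hL0.eq_or_lt with h0 | h0
  · have hl : ∀ r ∈ s, l r = 0 := fun r hr ↦
      abs_eq_zero.1 ((Finset.sum_eq_zero_iff_of_nonneg fun _ _ ↦ abs_nonneg _).1 h0.symm r hr)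
    rw [Finset.sum_eq_zero fun r hr ↦ by rw [hl r hr, zero_smul],
      Finset.sum_eq_zero fun r hr ↦ by rw [hl r hr, zero_smul], ← h0]
    simp
  · let e : Fin s.card → R := fun i ↦ s.equivFin.symm i
    have hsum : ∑ i, |L⁻¹ * l (e i)| = 1 := by
      rw [s.equivFin.symm.sum_comp fun r : s ↦ |L⁻¹ * l r|,
        Finset.sum_coe_sort s fun r ↦ |L⁻¹ * l r|]
      simp_rw [abs_mul, abs_inv, abs_of_pos h0, ← Finset.mul_sum]
      exact inv_mul_cancel₀ h0.ne'
    have key := h s.card (fun i ↦ (e i).1) (fun i ↦ (e i).2) (fun i ↦ L⁻¹ * l (e i)) hsum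
    rw [s.equivFin.symm.sum_comp fun r : s ↦ (L⁻¹ * l r) • r.1.1.1,
      s.equivFin.symm.sum_comp fun r : s ↦ (L⁻¹ * l r) • r.1.1.2,
      Finset.sum_coe_sort s fun r ↦ (L⁻¹ * l r) • r.1.1,
      Finset.sum_coe_sort s fun r ↦ (L⁻¹ * l r) • r.1.2] at key
    simp_rw [mul_smul, ← Finset.smul_sum, norm_smul, norm_inv, Real.norm_eq_abs, abs_of_pos h0,
      ← mul_sub, abs_mul, abs_inv, abs_of_pos h0] at key
    rwa [inv_mul_le_iff₀ h0, mul_comm] at key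

/-- Gluing `A` and `B` along a family of pairs: if the norms of linear combinations of the two
components differ by at most the norm of the corresponding combination of vectors `u r` of an
auxiliary Banach space `F`, then the pairs can be brought within `‖u r‖` of each other. -/
theorem exists_linearIsometry_norm_sub_le_norm {A B F : Type} {ι : Type*}
    [NormedAddCommGroup A] [NormedSpace ℝ A] [CompleteSpace A]
    [NormedAddCommGroup B] [NormedSpace ℝ B] [CompleteSpace B]
    [NormedAddCommGroup F] [NormedSpace ℝ F] [CompleteSpace F]
    (a : ι → A) (b : ι → B) (u : ι → F)
    (h : ∀ (s : Finset ι) (l : ι → ℝ),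
      |‖∑ r ∈ s, l r • a r‖ - ‖∑ r ∈ s, l r • b r‖| ≤ ‖∑ r ∈ s, l r • u r‖) :
    ∃ (C : Type) (_ : NormedAddCommGroup C) (_ : NormedSpace ℝ C) (_ : CompleteSpace C)
      (ιA : A →ₗᵢ[ℝ] C) (ιB : B →ₗᵢ[ℝ] C), ∀ r, ‖ιA (a r) - ιB (b r)‖ ≤ ‖u r‖ := by
  let V := WithLp 1 (A × WithLp 1 (B × F))
  let πA : V →L[ℝ] A := WithLp.fstL 1 ℝ A (WithLp 1 (B × F))
  let πB : V →L[ℝ] B := WithLp.fstL 1 ℝ B F ∘L WithLp.sndL 1 ℝ A (WithLp 1 (B × F))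
  let πF : V →L[ℝ] F := WithLp.sndL 1 ℝ B F ∘L WithLp.sndL 1 ℝ A (WithLp 1 (B × F))
  have norm_eq : ∀ v : V, ‖v‖ = ‖πA v‖ + (‖πB v‖ + ‖πF v‖) := fun v ↦
    (WithLp.prod_norm_eq_of_L1 v).trans
      (congrArg (‖v.fst‖ + ·) (WithLp.prod_norm_eq_of_L1 v.snd))
  have ext_V : ∀ {v w : V}, πA v = πA w → πB v = πB w → πF v = πF w → v = w :=
    fun {v w} hA hB hF ↦ by
      rw [← sub_eq_zero, ← norm_eq_zero, norm_eq, map_sub, map_sub, map_sub, hA, hB, hF]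
      simp
  let mk : A → B → F → V := fun x y z ↦ WithLp.toLp 1 (x, WithLp.toLp 1 (y, z))
  have mkA : ∀ x y z, πA (mk x y z) = x := fun _ _ _ ↦ rfl
  have mkB : ∀ x y z, πB (mk x y z) = y := fun _ _ _ ↦ rfl
  have mkF : ∀ x y z, πF (mk x y z) = z := fun _ _ _ ↦ rfl
  clear_value mk πA πB πF
  let g : ι → V := fun r ↦ mk (a r) (-b r) (-u r)
  let N : Submodule ℝ V := (Submodule.span ℝ (Set.range g)).topologicalClosure
  have hNc : IsClosed (N : Set V) := Submodule.isClosed_topologicalClosure _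
  have hN : ∀ n ∈ N, |‖πA n‖ - ‖πB n‖| ≤ ‖πF n‖ := by
    have hcl : IsClosed {n : V | |‖πA n‖ - ‖πB n‖| ≤ ‖πF n‖} :=
      isClosed_le (πA.continuous.norm.sub πB.continuous.norm).abs πF.continuous.norm
    refine closure_minimal (fun n hn ↦ ?_) hcl
    obtain ⟨l, rfl⟩ := Finsupp.mem_span_range_iff_exists_finsupp.1 hn
    change |‖πA _‖ - ‖πB _‖| ≤ ‖πF _‖
    simpa [Finsupp.sum, map_sum, g, mkA, mkB, mkF] using h l.support l
  let fA : A →ₗᵢ[ℝ] V :=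
    { toFun := fun x ↦ mk x 0 0
      map_add' := fun x y ↦ by apply ext_V <;> simp [mkA, mkB, mkF]
      map_smul' := fun t x ↦ by apply ext_V <;> simp [mkA, mkB, mkF]
      norm_map' := fun x ↦ by simp [norm_eq, mkA, mkB, mkF] }
  let fB : B →ₗᵢ[ℝ] V :=
    { toFun := fun y ↦ mk 0 y 0
      map_add' := fun x y ↦ by apply ext_V <;> simp [mkA, mkB, mkF]
      map_smul' := fun t x ↦ by apply ext_V <;> simp [mkA, mkB, mkF]
      norm_map' := fun x ↦ by simp [norm_eq, mkA, mkB, mkF] }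
  have fA_apply : ∀ x, fA x = mk x 0 0 := fun _ ↦ rfl
  have fB_apply : ∀ y, fB y = mk 0 y 0 := fun _ ↦ rfl
  have hfA : ∀ x, ∀ n ∈ N, ‖x‖ ≤ ‖fA x + n‖ := fun x n hn ↦ by
    have h1 : ‖fA x + n‖ = ‖x + πA n‖ + (‖πB n‖ + ‖πF n‖) := by
      simp [norm_eq, fA_apply, mkA, mkB, mkF]
    have h2 := norm_sub_le (x + πA n) (πA n)
    rw [add_sub_cancel_right] at h2
    linarith [(abs_le.1 (hN n hn)).2]
  have hfB : ∀ x, ∀ n ∈ N, ‖x‖ ≤ ‖fB x + n‖ := fun x n hn ↦ by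
    have h1 : ‖fB x + n‖ = ‖πA n‖ + (‖x + πB n‖ + ‖πF n‖) := by
      simp [norm_eq, fB_apply, mkA, mkB, mkF]
    have h2 := norm_sub_le (x + πB n) (πB n)
    rw [add_sub_cancel_right] at h2
    linarith [(abs_le.1 (hN n hn)).1]
  refine ⟨V ⧸ N, inferInstance, inferInstance, inferInstance,
    fA.toQuotient N hfA, fB.toQuotient N hfB, fun r ↦ ?_⟩
  let e : V := mk 0 0 (u r)
  have he : ‖e‖ = ‖u r‖ := by simp [norm_eq, e, mkA, mkB, mkF]
  have hq : fA.toQuotient N hfA (a r) - fB.toQuotient N hfB (b r)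
      = Submodule.Quotient.mk e := by
    rw [LinearIsometry.toQuotient_apply, LinearIsometry.toQuotient_apply,
      ← Submodule.Quotient.mk_sub, Submodule.Quotient.eq]
    have hg : fA (a r) - fB (b r) - e = g r := by
      apply ext_V <;> simp [fA_apply, fB_apply, e, g, mkA, mkB, mkF]
    rw [hg]
    exact Submodule.le_topologicalClosure _ (Submodule.subset_span (Set.mem_range_self _))
  rw [hq, ← he]
  exact Submodule.Quotient.norm_mk_le N e

/-- Two Banach spaces with a relation that distorts the norms of linear combinations by at most
`c` times the `ℓ¹` norm of the coefficients embed in a common Banach space in which related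
vectors are at distance at most `c`. -/
theorem exists_linearIsometry_norm_sub_le {A B : Type}
    [NormedAddCommGroup A] [NormedSpace ℝ A] [CompleteSpace A]
    [NormedAddCommGroup B] [NormedSpace ℝ B] [CompleteSpace B]
    {c : ℝ} (hc : 0 ≤ c) (R : Set (A × B))
    (h : ∀ (s : Finset R) (l : R → ℝ),
      |‖∑ r ∈ s, l r • r.1.1‖ - ‖∑ r ∈ s, l r • r.1.2‖| ≤ c * ∑ r ∈ s, |l r|) :
    ∃ (C : Type) (_ : NormedAddCommGroup C) (_ : NormedSpace ℝ C) (_ : CompleteSpace C)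
      (ιA : A →ₗᵢ[ℝ] C) (ιB : B →ₗᵢ[ℝ] C), ∀ r ∈ R, ‖ιA r.1 - ιB r.2‖ ≤ c := by
  classical
  let u : R → lp (fun _ : R ↦ ℝ) 1 := fun r ↦ lp.single 1 r c
  have hu : ∀ (s : Finset R) (l : R → ℝ), ‖∑ r ∈ s, l r • u r‖ = c * ∑ r ∈ s, |l r| :=
    fun s l ↦ by
      have := lp.norm_sum_single (E := fun _ : R ↦ ℝ) (p := 1) (by simp) (fun r ↦ l r • c) s
      simp only [lp.single_smul, ENNReal.toReal_one, Real.rpow_one, norm_smul, Real.norm_eq_abs,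
        abs_of_nonneg hc, ← Finset.sum_mul] at this
      rw [this, mul_comm]
  obtain ⟨C, i₁, i₂, i₃, ιA, ιB, hι⟩ := exists_linearIsometry_norm_sub_le_norm
    (fun r : R ↦ r.1.1) (fun r ↦ r.1.2) u fun s l ↦ (h s l).trans_eq (hu s l).symm
  refine ⟨C, i₁, i₂, i₃, ιA, ιB, fun r hr ↦ (hι ⟨r, hr⟩).trans_eq ?_⟩
  simp [u, lp.norm_single, abs_of_nonneg hc]

/-- If the images of every point of `s` under `f` lie within `r` of `t`, then so do those of
the closure points of `s`. -/
theorem infEDist_le_of_mem_closure {X Z : Type*} [TopologicalSpace X] [PseudoEMetricSpace Z]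
    {f : X → Z} (hf : Continuous f) {s : Set X} {t : Set Z} {r : ℝ≥0∞}
    (h : ∀ x ∈ s, Metric.infEDist (f x) t ≤ r) {x : X} (hx : x ∈ closure s) :
    Metric.infEDist (f x) t ≤ r :=
  closure_minimal (t := {x | Metric.infEDist (f x) t ≤ r}) h
    (isClosed_le (Metric.continuous_infEDist.comp hf) continuous_const) hx

/-- If a correspondence `R` between dense subsets of the closed unit
balls of real Banach spaces `A` and `B` preserves the norms of absolutely convex
combinations up to additive error `ε − δ` (where `0 < δ < ε`), then `A` and `B` embed
by linear isometries into a common Banach space `C` in which the images of their unit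
balls have Hausdorff distance `< ε`; in particular `d_K(A, B) < ε`. -/
theorem stmt15 {A B : Type}
    [NormedAddCommGroup A] [NormedSpace ℝ A] [CompleteSpace A]
    [NormedAddCommGroup B] [NormedSpace ℝ B] [CompleteSpace B]
    (ε δ : ℝ) (hδ : 0 < δ) (hδε : δ < ε)
    (Ahat : Set A) (Bhat : Set B)
    (hA₁ : Ahat ⊆ Metric.closedBall 0 1) (hA₂ : Metric.closedBall 0 1 ⊆ closure Ahat)
    (hB₁ : Bhat ⊆ Metric.closedBall 0 1) (hB₂ : Metric.closedBall 0 1 ⊆ closure Bhat)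
    (R : Set (A × B)) (hdom : Prod.fst '' R = Ahat) (hran : Prod.snd '' R = Bhat)
    (h : ∀ (n : ℕ) (p : Fin n → A × B), (∀ i, p i ∈ R) →
      ∀ lam : Fin n → ℝ, ∑ i, |lam i| = 1 →
        |‖∑ i, lam i • (p i).1‖ - ‖∑ i, lam i • (p i).2‖| ≤ ε - δ) :
    (∃ (C : Type) (_ : NormedAddCommGroup C) (_ : NormedSpace ℝ C) (_ : CompleteSpace C)
      (ιA : A →ₗᵢ[ℝ] C) (ιB : B →ₗᵢ[ℝ] C),
        hausdorffEdist (ιA '' Metric.closedBall 0 1) (ιB '' Metric.closedBall 0 1)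
          < ENNReal.ofReal ε) ∧
    kadetsEDist A B < ENNReal.ofReal ε := by
  have hc : 0 < ε - δ := sub_pos.2 hδε
  obtain ⟨C, i₁, i₂, i₃, ιA, ιB, hι⟩ :=
    exists_linearIsometry_norm_sub_le hc.le R (abs_norm_sub_norm_le_of_absConvex h)
  have hedist : ∀ r ∈ R, edist (ιA r.1) (ιB r.2) ≤ ENNReal.ofReal (ε - δ) := fun r hr ↦ by
    rw [edist_dist, dist_eq_norm]
    exact ENNReal.ofReal_le_ofReal (hι r hr)
  have hlt : hausdorffEdist (ιA '' Metric.closedBall 0 1) (ιB '' Metric.closedBall 0 1)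
      < ENNReal.ofReal ε := by
    refine lt_of_le_of_lt (Metric.hausdorffEDist_le_of_infEDist (r := ENNReal.ofReal (ε - δ)) ?_ ?_)
      ((ENNReal.ofReal_lt_ofReal_iff (hδ.trans hδε)).2 (sub_lt_self _ hδ))
    · rintro _ ⟨a, ha, rfl⟩
      refine infEDist_le_of_mem_closure ιA.continuous (fun x hx ↦ ?_) (hA₂ ha)
      obtain ⟨r, hr, rfl⟩ := hdom.symm ▸ hx
      exact (Metric.infEDist_le_edist_of_mem
        (mem_image_of_mem ιB (hB₁ (hran ▸ mem_image_of_mem _ hr)))).trans (hedist r hr)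
    · rintro _ ⟨b, hb, rfl⟩
      refine infEDist_le_of_mem_closure ιB.continuous (fun x hx ↦ ?_) (hB₂ hb)
      obtain ⟨r, hr, rfl⟩ := hran.symm ▸ hx
      exact (Metric.infEDist_le_edist_of_mem
        (mem_image_of_mem ιA (hA₁ (hdom ▸ mem_image_of_mem _ hr)))).trans
        (edist_comm (ιA r.1) _ ▸ hedist r hr)
  exact ⟨⟨C, i₁, i₂, i₃, ιA, ιB, hlt⟩,
    LE.le.trans_lt (sInf_le ⟨C, i₁, i₂, i₃, ιA, ιB, rfl⟩) hlt⟩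
end

section
/- Let A and B be real Banach spaces with closed unit balls B_A and B_B. Then the Kadets distance d_K(A, B) equals the infimum of all ε ≥ 0 for which there exist dense subsets Â ⊆ B_A and B̂ ⊆ B_B, a correspondence R between Â and B̂, a real Banach space C, and linear isometric embeddings ι_A : A → C and ι_B : B → C such that ‖ι_A(a) − ι_B(b)‖ ≤ ε for all (a,b) ∈ R. -/
open EMetric Set ENNReal

/-- The images of a set and of a dense subset of it under a continuous map are at Hausdorff
distance zero. -/
theorem hausdorffEDist_image_eq_zero_of_subset_closure {X Y : Type*} [TopologicalSpace X]
    [PseudoEMetricSpace Y] {f : X → Y} (hf : Continuous f) {s t : Set X}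
    (hst : s ⊆ t) (hts : t ⊆ closure s) :
    Metric.hausdorffEDist (f '' s) (f '' t) = 0 := by
  rw [Metric.hausdorffEDist_zero_iff_closure_eq_closure]
  refine (closure_mono (image_mono hst)).antisymm (closure_minimal ?_ isClosed_closure)
  exact (image_mono hts).trans (image_closure_subset_closure_image hf)

/-- The Kadets distance of two real Banach spaces `A`, `B` equals the
infimum of all `ε` for which there are dense subsets `Â`, `B̂` of the closed unit balls
of `A` and `B`, a correspondence `R` between `Â` and `B̂`, and linear isometric
embeddings of `A` and `B` into a common Banach space `C` with
`‖ι_A(a) − ι_B(b)‖ ≤ ε` for all `(a, b) ∈ R`. -/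
theorem stmt16 {A B : Type}
    [NormedAddCommGroup A] [NormedSpace ℝ A] [CompleteSpace A]
    [NormedAddCommGroup B] [NormedSpace ℝ B] [CompleteSpace B] :
    kadetsEDist A B =
      sInf { ε : ℝ≥0∞ |
        ∃ (Ahat : Set A) (Bhat : Set B),
          Ahat ⊆ Metric.closedBall 0 1 ∧ Metric.closedBall 0 1 ⊆ closure Ahat ∧
          Bhat ⊆ Metric.closedBall 0 1 ∧ Metric.closedBall 0 1 ⊆ closure Bhat ∧
          ∃ R : Set (A × B),
            Prod.fst '' R = Ahat ∧ Prod.snd '' R = Bhat ∧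
            ∃ (C : Type) (_ : NormedAddCommGroup C) (_ : NormedSpace ℝ C)
              (_ : CompleteSpace C) (ιA : A →ₗᵢ[ℝ] C) (ιB : B →ₗᵢ[ℝ] C),
              ∀ p ∈ R, edist (ιA p.1) (ιB p.2) ≤ ε } := by
  unfold kadetsEDist
  apply le_antisymm
  · refine le_sInf ?_
    rintro ε ⟨_, _, hA, hA', hB, hB', R, rfl, rfl, C, _, _, _, ιA, ιB, hR⟩
    refine sInf_le_of_le ⟨C, _, _, inferInstance, ιA, ιB, rfl⟩ ?_
    have hAB : Metric.hausdorffEDist (ιA '' (Prod.fst '' R)) (ιB '' (Prod.snd '' R)) ≤ ε := by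
      refine Metric.hausdorffEDist_le_of_mem_edist ?_ ?_
      · rintro _ ⟨_, ⟨p, hp, rfl⟩, rfl⟩
        exact ⟨ιB p.2, mem_image_of_mem _ (mem_image_of_mem _ hp), hR p hp⟩
      · rintro _ ⟨_, ⟨p, hp, rfl⟩, rfl⟩
        exact ⟨ιA p.1, mem_image_of_mem _ (mem_image_of_mem _ hp),
          (edist_comm _ _).trans_le (hR p hp)⟩
    have hA0 := hausdorffEDist_image_eq_zero_of_subset_closure ιA.continuous hA hA'
    have hB0 := hausdorffEDist_image_eq_zero_of_subset_closure ιB.continuous hB hB'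
    rw [Metric.hausdorffEDist_comm] at hA0
    calc Metric.hausdorffEDist (ιA '' Metric.closedBall 0 1) (ιB '' Metric.closedBall 0 1)
        ≤ Metric.hausdorffEDist (ιA '' Metric.closedBall 0 1) (ιA '' (Prod.fst '' R)) +
          (Metric.hausdorffEDist (ιA '' (Prod.fst '' R)) (ιB '' (Prod.snd '' R)) +
          Metric.hausdorffEDist (ιB '' (Prod.snd '' R)) (ιB '' Metric.closedBall 0 1)) :=
          Metric.hausdorffEDist_triangle.trans
            (add_le_add_right Metric.hausdorffEDist_triangle _)
      _ ≤ ε := by rwa [hA0, hB0, zero_add, add_zero]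
  · refine le_sInf ?_
    rintro r ⟨Z, _, _, _, ιA, ιB, rfl⟩
    refine le_of_forall_gt_imp_ge_of_dense fun ε hε => sInf_le ?_
    refine ⟨_, _, Subset.rfl, subset_closure, Subset.rfl, subset_closure,
      {p | p.1 ∈ Metric.closedBall 0 1 ∧ p.2 ∈ Metric.closedBall 0 1 ∧
        edist (ιA p.1) (ιB p.2) ≤ ε}, ?_, ?_, Z, _, _, inferInstance, ιA, ιB,
      fun p hp => hp.2.2⟩
    · refine Subset.antisymm (image_subset_iff.2 fun p hp => hp.1) fun a ha => ?_
      obtain ⟨_, ⟨b, hb, rfl⟩, hab⟩ :=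
        Metric.exists_edist_lt_of_hausdorffEDist_lt (mem_image_of_mem ιA ha) hε
      exact ⟨(a, b), ⟨ha, hb, hab.le⟩, rfl⟩
    · refine Subset.antisymm (image_subset_iff.2 fun p hp => hp.2.1) fun b hb => ?_
      obtain ⟨_, ⟨a, ha, rfl⟩, hab⟩ := Metric.exists_edist_lt_of_hausdorffEDist_lt
        (mem_image_of_mem ιB hb) (Metric.hausdorffEDist_comm.trans_lt hε)
      exact ⟨(a, b), ⟨ha, hb, (edist_comm _ _).trans_le hab.le⟩, rfl⟩
end
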